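/- For all Φ, Ψ ∈ S^c and all (x,y,p) ∈ ℝ × 𝕋 × ℤ, the series (Φ★Ψ)(x,y,p) = Σ_{q∈ℤ} Φ(x−ħ(q−p)μ, y−ħ(q−p)ν, q) Ψ(x−ħqμ, y−ħqν, p−q) converges absolutely, and the resulting function Φ★Ψ again belongs to S^c. -/

import Mathlib

open MeasureTheory Complex

noncomputable section

/-- `e x = exp (2 π i x)`. -/
def expi (x : ℝ) : ℂ := Complex.exp (2 * Real.pi * Complex.I * x)

/-- Partial derivative in the first variable. -/
def pdX (f : ℝ → ℝ → ℂ) : ℝ → ℝ → ℂ := fun x y => deriv (fun x' => f x' y) x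

/-- Partial derivative in the second variable. -/
def pdY (f : ℝ → ℝ → ℂ) : ℝ → ℝ → ℂ := fun x y => deriv (fun y' => f x y') y

/-- The space `S^c`: smooth functions on `ℝ × 𝕋 × ℤ` (a function on the torus `𝕋`
is identified with a `1`-periodic function on `ℝ`) satisfying the quasi-periodicity
relation `Φ(x+k,y,p) = e(ckpy) Φ(x,y,p)` for `k ∈ ℤ`, together with the
Schwartz-type bounds: for every polynomial `P` on `ℤ`, all partial derivatives
`X̃ = ∂^{m+n}/∂x^m ∂y^n` and every compact `K ⊆ ℝ × 𝕋`, the function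
`P(p)(X̃Φ)(x,y,p)` is bounded on `K × ℤ`. -/
def IsSc (c : ℕ) (Φ : ℝ → ℝ → ℤ → ℂ) : Prop :=
  (∀ p : ℤ, ContDiff ℝ (⊤ : ℕ∞) (fun xy : ℝ × ℝ => Φ xy.1 xy.2 p)) ∧
  (∀ (x y : ℝ) (p : ℤ), Φ x (y + 1) p = Φ x y p) ∧
  (∀ (k : ℤ) (x y : ℝ) (p : ℤ),
    Φ (x + k) y p = expi ((c : ℝ) * (k : ℝ) * (p : ℝ) * y) * Φ x y p) ∧
  (∀ (P : Polynomial ℤ) (m n : ℕ) (K : Set (ℝ × ℝ)), IsCompact K →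
    ∃ C : ℝ, ∀ (x y : ℝ) (p : ℤ), (x, y) ∈ K →
      ‖((P.eval p : ℤ) : ℂ) * pdX^[m] (pdY^[n] (fun x' y' => Φ x' y' p)) x y‖ ≤ C)

/-- The product `★` of the quantum Heisenberg manifold. -/
def starProd (hbar μ ν : ℝ) (Φ Ψ : ℝ → ℝ → ℤ → ℂ) : ℝ → ℝ → ℤ → ℂ :=
  fun x y p => ∑' q : ℤ,
    Φ (x - hbar * ((q : ℝ) - (p : ℝ)) * μ) (y - hbar * ((q : ℝ) - (p : ℝ)) * ν) q *
      Ψ (x - hbar * (q : ℝ) * μ) (y - hbar * (q : ℝ) * ν) (p - q)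

/-- The involution `Φ*(x,y,p) = conj (Φ(x,y,-p))`. -/
def invol (Φ : ℝ → ℝ → ℤ → ℂ) : ℝ → ℝ → ℤ → ℂ :=
  fun x y p => starRingEnd ℂ (Φ x y (-p))

/-- The group multiplication on `G = ℝ³`: `(r,s,t)(r',s',t') = (r+r', s+s', t+t'+csr')`. -/
def heisMul (c : ℕ) (g h : ℝ × ℝ × ℝ) : ℝ × ℝ × ℝ :=
  (g.1 + h.1, g.2.1 + h.2.1, g.2.2 + h.2.2 + (c : ℝ) * g.2.1 * h.1)

/-- The action of `G = ℝ³` on `S^c`. -/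
def Lact (c : ℕ) (g : ℝ × ℝ × ℝ) (Φ : ℝ → ℝ → ℤ → ℂ) : ℝ → ℝ → ℤ → ℂ :=
  fun x y p =>
    expi ((p : ℝ) * (g.2.2 + (c : ℝ) * g.2.1 * (x - g.1))) * Φ (x - g.1) (y - g.2.1) p

/-- The trace `τ(Φ) = ∫₀¹ ∫_𝕋 Φ(x,y,0) dy dx`. -/
def tauQHM (Φ : ℝ → ℝ → ℤ → ℂ) : ℂ := ∫ x in (0:ℝ)..1, ∫ y in (0:ℝ)..1, Φ x y 0

/-- The derivation `d₁(Φ) = -∂Φ/∂x`. -/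
def d1 (Φ : ℝ → ℝ → ℤ → ℂ) : ℝ → ℝ → ℤ → ℂ :=
  fun x y p => - deriv (fun x' => Φ x' y p) x

/-- The derivation `d₂(Φ)(x,y,p) = 2πicpx·Φ(x,y,p) - ∂Φ/∂y(x,y,p)`. -/
def d2 (c : ℕ) (Φ : ℝ → ℝ → ℤ → ℂ) : ℝ → ℝ → ℤ → ℂ :=
  fun x y p => ((2 * Real.pi * (c : ℝ) * (p : ℝ) * x : ℝ) : ℂ) * Complex.I * Φ x y p -
    deriv (fun y' => Φ x y' p) y

/-- The derivation `d₃(Φ)(x,y,p) = 2πipcα·Φ(x,y,p)`. -/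
def d3 (c : ℕ) (α : ℝ) (Φ : ℝ → ℝ → ℤ → ℂ) : ℝ → ℝ → ℤ → ℂ :=
  fun x y p => ((2 * Real.pi * (p : ℝ) * (c : ℝ) * α : ℝ) : ℂ) * Complex.I * Φ x y p

/-- The measure on `ℝ × 𝕋 × ℤ`, the torus being identified with `[0,1)`:
Lebesgue measure on `ℝ`, Lebesgue measure restricted to `[0,1)`, and
counting measure on `ℤ`. -/
def μQHM : Measure (ℝ × ℝ × ℤ) :=
  (volume : Measure ℝ).prod
    (((volume : Measure ℝ).restrict (Set.Ico (0:ℝ) 1)).prod Measure.count)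

/-- `RepOf hbar μ ν Φ T` says that the bounded operator `T` on `L²(ℝ × 𝕋 × ℤ)` is
given by the formula `(π(Φ)ξ)(x,y,p) = Σ_q Φ(x-hbar(q-2p)μ, y-hbar(q-2p)ν, q) ξ(x,y,p-q)`. -/
def RepOf (hbar μ ν : ℝ) (Φ : ℝ → ℝ → ℤ → ℂ) (T : Lp ℂ 2 μQHM →L[ℂ] Lp ℂ 2 μQHM) : Prop :=
  ∀ ξ : Lp ℂ 2 μQHM,
    (T ξ : ℝ × ℝ × ℤ → ℂ) =ᵐ[μQHM]
      fun w => ∑' q : ℤ,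
        Φ (w.1 - hbar * ((q : ℝ) - 2 * (w.2.2 : ℝ)) * μ)
            (w.2.1 - hbar * ((q : ℝ) - 2 * (w.2.2 : ℝ)) * ν) q *
          (ξ : ℝ × ℝ × ℤ → ℂ) (w.1, w.2.1, w.2.2 - q)

/-- Directional derivative along the first axis. -/
def dX (f : ℝ × ℝ → ℂ) : ℝ × ℝ → ℂ := fun z => fderiv ℝ f z (1, 0)

/-- Directional derivative along the second axis. -/
def dY (f : ℝ × ℝ → ℂ) : ℝ × ℝ → ℂ := fun z => fderiv ℝ f z (0, 1)

/-- Smoothness. -/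
abbrev Smooth (f : ℝ × ℝ → ℂ) : Prop := ContDiff ℝ (⊤ : ℕ∞) f

lemma Smooth.fd {f : ℝ × ℝ → ℂ} (hf : Smooth f) : ContDiff ℝ (⊤ : ℕ∞) (fderiv ℝ f) :=
  hf.fderiv_right (by simp)

lemma Smooth.nat {f : ℝ × ℝ → ℂ} (hf : Smooth f) (n : ℕ) : ContDiff ℝ n f :=
  hf.of_le (by exact_mod_cast le_top)

lemma Smooth.diff {f : ℝ × ℝ → ℂ} (hf : Smooth f) : Differentiable ℝ f :=
  hf.differentiable (by simp)

lemma Smooth.dX {f : ℝ × ℝ → ℂ} (hf : Smooth f) : Smooth (dX f) :=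
  hf.fd.clm_apply contDiff_const

lemma Smooth.dY {f : ℝ × ℝ → ℂ} (hf : Smooth f) : Smooth (dY f) :=
  hf.fd.clm_apply contDiff_const

lemma Smooth.dXn {f : ℝ × ℝ → ℂ} (hf : Smooth f) (n : ℕ) : Smooth (_root_.dX^[n] f) := by
  induction n with
  | zero => exact hf
  | succ n ih => rw [Function.iterate_succ_apply']; exact ih.dX

lemma Smooth.dYn {f : ℝ × ℝ → ℂ} (hf : Smooth f) (n : ℕ) : Smooth (_root_.dY^[n] f) := by
  induction n with
  | zero => exact hf
  | succ n ih => rw [Function.iterate_succ_apply']; exact ih.dY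

lemma dX_dY_comm {f : ℝ × ℝ → ℂ} (hf : Smooth f) : dX (dY f) = dY (dX f) := by
  funext z
  have h1 : ∀ v w : ℝ × ℝ, fderiv ℝ (fun z => fderiv ℝ f z v) z w
      = fderiv ℝ (fderiv ℝ f) z w v := by
    intro v w
    rw [fderiv_clm_apply (hf.fd.differentiable (by simp) z) (differentiableAt_const _)]
    simp
  have h2 : IsSymmSndFDerivAt ℝ f z :=
    hf.contDiffAt.isSymmSndFDerivAt (by
      simpa using WithTop.coe_le_coe.2 (le_top : (2 : ℕ∞) ≤ ⊤))
  change fderiv ℝ (fun z => fderiv ℝ f z (0, 1)) z (1, 0)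
    = fderiv ℝ (fun z => fderiv ℝ f z (1, 0)) z (0, 1)
  rw [h1, h1]
  exact h2 _ _

lemma dYn_dX_comm {f : ℝ × ℝ → ℂ} (hf : Smooth f) (n : ℕ) : dY^[n] (dX f) = dX (dY^[n] f) := by
  induction n with
  | zero => rfl
  | succ n ih =>
    rw [Function.iterate_succ_apply', Function.iterate_succ_apply', ih, dX_dY_comm (hf.dYn n)]

lemma pdX_eq {f : ℝ × ℝ → ℂ} (hf : Smooth f) :
    pdX (fun x y => f (x, y)) = fun x y => dX f (x, y) := by
  funext x y
  have h : HasDerivAt (fun x' : ℝ => ((x', y) : ℝ × ℝ)) (1, 0) x :=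
    (hasDerivAt_id x).prodMk (hasDerivAt_const x y)
  exact ((hf.diff (x, y)).hasFDerivAt.comp_hasDerivAt x h).deriv

lemma pdY_eq {f : ℝ × ℝ → ℂ} (hf : Smooth f) :
    pdY (fun x y => f (x, y)) = fun x y => dY f (x, y) := by
  funext x y
  have h : HasDerivAt (fun y' : ℝ => ((x, y') : ℝ × ℝ)) (0, 1) y :=
    (hasDerivAt_const y x).prodMk (hasDerivAt_id y)
  exact ((hf.diff (x, y)).hasFDerivAt.comp_hasDerivAt y h).deriv

lemma pdXn_eq {f : ℝ × ℝ → ℂ} (hf : Smooth f) (n : ℕ) :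
    pdX^[n] (fun x y => f (x, y)) = fun x y => dX^[n] f (x, y) := by
  induction n with
  | zero => rfl
  | succ n ih => rw [Function.iterate_succ_apply', Function.iterate_succ_apply', ih,
      pdX_eq (hf.dXn n)]

lemma pdYn_eq {f : ℝ × ℝ → ℂ} (hf : Smooth f) (n : ℕ) :
    pdY^[n] (fun x y => f (x, y)) = fun x y => dY^[n] f (x, y) := by
  induction n with
  | zero => rfl
  | succ n ih => rw [Function.iterate_succ_apply', Function.iterate_succ_apply', ih,
      pdY_eq (hf.dYn n)]

lemma pd_eq {f : ℝ × ℝ → ℂ} (hf : Smooth f) (m n : ℕ) (x y : ℝ) :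
    pdX^[m] (pdY^[n] (fun x y => f (x, y))) x y = dX^[m] (dY^[n] f) (x, y) := by
  rw [pdYn_eq hf, pdXn_eq (hf.dYn n)]

lemma norm_D_dX_le {f : ℝ × ℝ → ℂ} (hf : Smooth f) (k : ℕ) (z : ℝ × ℝ) :
    ‖iteratedFDeriv ℝ k (dX f) z‖ ≤ ‖iteratedFDeriv ℝ (k + 1) f z‖ := by
  have := norm_iteratedFDeriv_clm_apply_const (𝕜 := ℝ) (f := fderiv ℝ f) (c := ((1, 0) : ℝ × ℝ))
    (x := z) (n := k) (N := (⊤ : ℕ∞)) hf.fd.contDiffAt (by exact_mod_cast le_top)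
  rw [norm_iteratedFDeriv_fderiv] at this
  refine this.trans_eq ?_
  simp [Prod.norm_def]

lemma norm_D_dY_le {f : ℝ × ℝ → ℂ} (hf : Smooth f) (k : ℕ) (z : ℝ × ℝ) :
    ‖iteratedFDeriv ℝ k (dY f) z‖ ≤ ‖iteratedFDeriv ℝ (k + 1) f z‖ := by
  have := norm_iteratedFDeriv_clm_apply_const (𝕜 := ℝ) (f := fderiv ℝ f) (c := ((0, 1) : ℝ × ℝ))
    (x := z) (n := k) (N := (⊤ : ℕ∞)) hf.fd.contDiffAt (by exact_mod_cast le_top)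
  rw [norm_iteratedFDeriv_fderiv] at this
  refine this.trans_eq ?_
  simp [Prod.norm_def]

lemma norm_D_dXn_le {f : ℝ × ℝ → ℂ} (hf : Smooth f) (m k : ℕ) (z : ℝ × ℝ) :
    ‖iteratedFDeriv ℝ k (dX^[m] f) z‖ ≤ ‖iteratedFDeriv ℝ (k + m) f z‖ := by
  induction m generalizing k with
  | zero => rfl
  | succ m ih =>
    rw [Function.iterate_succ_apply']
    refine (norm_D_dX_le (hf.dXn m) k z).trans ((ih (k + 1)).trans_eq ?_)
    rw [show k + 1 + m = k + (m + 1) by ring]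

lemma norm_D_dYn_le {f : ℝ × ℝ → ℂ} (hf : Smooth f) (m k : ℕ) (z : ℝ × ℝ) :
    ‖iteratedFDeriv ℝ k (dY^[m] f) z‖ ≤ ‖iteratedFDeriv ℝ (k + m) f z‖ := by
  induction m generalizing k with
  | zero => rfl
  | succ m ih =>
    rw [Function.iterate_succ_apply']
    refine (norm_D_dY_le (hf.dYn m) k z).trans ((ih (k + 1)).trans_eq ?_)
    rw [show k + 1 + m = k + (m + 1) by ring]

lemma norm_dXY_le {f : ℝ × ℝ → ℂ} (hf : Smooth f) (m n : ℕ) (z : ℝ × ℝ) :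
    ‖dX^[m] (dY^[n] f) z‖ ≤ ‖iteratedFDeriv ℝ (m + n) f z‖ := by
  rw [← norm_iteratedFDeriv_zero (𝕜 := ℝ)]
  refine (norm_D_dXn_le (hf.dYn n) m 0 z).trans ?_
  rw [zero_add]
  exact norm_D_dYn_le hf n m z

lemma norm_D_succ_le {f : ℝ × ℝ → ℂ} (hf : Smooth f) (k : ℕ) (z : ℝ × ℝ) :
    ‖iteratedFDeriv ℝ (k + 1) f z‖
      ≤ ‖iteratedFDeriv ℝ k (dX f) z‖ + ‖iteratedFDeriv ℝ k (dY f) z‖ := by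
  let A : ℂ →L[ℝ] (ℝ × ℝ →L[ℝ] ℂ) :=
    ContinuousLinearMap.smulRightL ℝ (ℝ × ℝ) ℂ (ContinuousLinearMap.fst ℝ ℝ ℝ)
  let B : ℂ →L[ℝ] (ℝ × ℝ →L[ℝ] ℂ) :=
    ContinuousLinearMap.smulRightL ℝ (ℝ × ℝ) ℂ (ContinuousLinearMap.snd ℝ ℝ ℝ)
  have hA : ‖A‖ ≤ 1 := by
    refine ContinuousLinearMap.opNorm_le_bound _ zero_le_one fun w => ?_
    change ‖ContinuousLinearMap.smulRight (ContinuousLinearMap.fst ℝ ℝ ℝ) w‖ ≤ _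
    rw [ContinuousLinearMap.norm_smulRight_apply]
    gcongr
    exact ContinuousLinearMap.norm_fst_le ..
  have hB : ‖B‖ ≤ 1 := by
    refine ContinuousLinearMap.opNorm_le_bound _ zero_le_one fun w => ?_
    change ‖ContinuousLinearMap.smulRight (ContinuousLinearMap.snd ℝ ℝ ℝ) w‖ ≤ _
    rw [ContinuousLinearMap.norm_smulRight_apply]
    gcongr
    exact ContinuousLinearMap.norm_snd_le ..
  have key : fderiv ℝ f = (A ∘ dX f) + (B ∘ dY f) := by
    funext z
    ext <;> simp [A, B, dX, dY]
  have hkA : ContDiff ℝ k (A ∘ dX f) := A.contDiff.comp (hf.dX.nat k)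
  have hkB : ContDiff ℝ k (B ∘ dY f) := B.contDiff.comp (hf.dY.nat k)
  rw [← norm_iteratedFDeriv_fderiv, key, iteratedFDeriv_add hkA hkB]
  refine (norm_add_le _ _).trans ?_
  have h1 := A.norm_iteratedFDeriv_comp_left (n := k) (hf.dX.nat k).contDiffAt (x := z) le_rfl
  have h2 := B.norm_iteratedFDeriv_comp_left (n := k) (hf.dY.nat k).contDiffAt (x := z) le_rfl
  refine add_le_add (h1.trans ?_) (h2.trans ?_)
  · exact mul_le_of_le_one_left (norm_nonneg _) hA
  · exact mul_le_of_le_one_left (norm_nonneg _) hB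

/-- The weight on the integers. -/
def wt (p : ℤ) : ℝ := 1 + |(p : ℝ)|

lemma one_le_wt (p : ℤ) : 1 ≤ wt p := by simp [wt]

lemma wt_pos (p : ℤ) : 0 < wt p := lt_of_lt_of_le one_pos (one_le_wt p)

lemma wt_le_mul (p q : ℤ) : wt p ≤ wt q * wt (p - q) := by
  have h : |(p : ℝ)| ≤ |(q : ℝ)| + |(p : ℝ) - q| := by
    simpa using abs_add_le (q : ℝ) (p - q)
  simp only [wt, Int.cast_sub]
  nlinarith [abs_nonneg (q : ℝ), abs_nonneg ((p : ℝ) - q)]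

lemma summable_wt : Summable fun q : ℤ => (wt q ^ 2)⁻¹ := by
  have h := (Real.summable_one_div_int_pow (p := 2)).2 (by norm_num)
  have h2 : Summable fun q : ℤ => 1 / (q : ℝ) ^ 2 + if q = 0 then (1 : ℝ) else 0 :=
    h.add (summable_of_ne_finset_zero (s := {0}) (by intro b hb; simp at hb; simp [hb]))
  refine Summable.of_nonneg_of_le (fun q => by have := wt_pos q; positivity) (fun q => ?_) h2
  by_cases hq : q = 0
  · simp [hq, wt]
  · simp only [hq, if_false, add_zero, one_div]
    have : 0 < |(q : ℝ)| := by positivity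
    rw [← sq_abs (q : ℝ)]
    gcongr
    simp [wt]

lemma poly_bound (P : Polynomial ℤ) :
    ∃ (C : ℝ) (N : ℕ), 0 ≤ C ∧ ∀ p : ℤ, |((P.eval p : ℤ) : ℝ)| ≤ C * wt p ^ N := by
  induction P using Polynomial.induction_on' with
  | add P Q hP hQ =>
    obtain ⟨C, N, hC, h⟩ := hP
    obtain ⟨C', N', hC', h'⟩ := hQ
    refine ⟨C + C', N + N', by positivity, fun p => ?_⟩
    rw [Polynomial.eval_add, Int.cast_add, add_mul]
    refine (abs_add_le _ _).trans (add_le_add ((h p).trans ?_) ((h' p).trans ?_))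
    · gcongr
      · exact one_le_wt p
      · omega
    · gcongr
      · exact one_le_wt p
      · omega
  | monomial n a =>
    refine ⟨|(a : ℝ)|, n, abs_nonneg _, fun p => ?_⟩
    rw [Polynomial.eval_monomial, Int.cast_mul, abs_mul, Int.cast_pow, abs_pow]
    gcongr
    simp [wt]

lemma bound_D (K : Set (ℝ × ℝ)) (k : ℕ) : ∀ (F : ℤ → ℝ × ℝ → ℂ), (∀ p, Smooth (F p)) →
    (∀ m n N : ℕ, ∃ C : ℝ, ∀ p, ∀ z ∈ K, wt p ^ N * ‖dX^[m] (dY^[n] (F p)) z‖ ≤ C) →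
    ∀ N : ℕ, ∃ C : ℝ, ∀ p, ∀ z ∈ K, wt p ^ N * ‖iteratedFDeriv ℝ k (F p) z‖ ≤ C := by
  induction k with
  | zero =>
    intro F _ h N
    obtain ⟨C, hC⟩ := h 0 0 N
    refine ⟨C, fun p z hz => ?_⟩
    rw [norm_iteratedFDeriv_zero]
    exact hC p z hz
  | succ k ih =>
    intro F hF h N
    obtain ⟨C1, h1⟩ := ih (fun p => dX (F p)) (fun p => (hF p).dX) (by
      intro m n N
      obtain ⟨C, hC⟩ := h (m + 1) n N
      refine ⟨C, fun p z hz => ?_⟩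
      rw [dYn_dX_comm (hF p)]
      exact hC p z hz) N
    obtain ⟨C2, h2⟩ := ih (fun p => dY (F p)) (fun p => (hF p).dY) (by
      intro m n N
      obtain ⟨C, hC⟩ := h m (n + 1) N
      exact ⟨C, fun p z hz => hC p z hz⟩) N
    refine ⟨C1 + C2, fun p z hz => ?_⟩
    have := norm_D_succ_le (hF p) k z
    have hw := pow_pos (wt_pos p) N
    calc _ ≤ wt p ^ N * (‖iteratedFDeriv ℝ k (dX (F p)) z‖ + ‖iteratedFDeriv ℝ k (dY (F p)) z‖) := by
          gcongr
      _ ≤ _ := by rw [mul_add]; exact add_le_add (h1 p z hz) (h2 p z hz)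

lemma smooth_expi (a : ℝ) : Smooth (fun z => expi (a * z.2)) := by
  unfold expi
  have : Smooth fun z : ℝ × ℝ => ((a * z.2 : ℝ) : ℂ) :=
    Complex.ofRealCLM.contDiff.comp (contDiff_const.mul contDiff_snd)
  exact (contDiff_const.mul this).cexp

lemma norm_expi (x : ℝ) : ‖expi x‖ = 1 := by
  unfold expi
  rw [show 2 * (Real.pi : ℂ) * I * x = ((2 * Real.pi * x : ℝ) : ℂ) * I by push_cast; ring]
  exact Complex.norm_exp_ofReal_mul_I _

lemma hasDerivAt_expi (a y : ℝ) :
    HasDerivAt (fun y : ℝ => expi (a * y)) ((2 * Real.pi * I * a) * expi (a * y)) y := by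
  unfold expi
  have h : HasDerivAt (fun y : ℝ => 2 * (Real.pi : ℂ) * I * ((a * y : ℝ) : ℂ))
      (2 * Real.pi * I * a) y := by
    have h1 : HasDerivAt (fun y : ℝ => a * y) a y := by
      simpa using (hasDerivAt_id y).const_mul a
    exact h1.ofReal_comp.const_mul _
  convert h.cexp using 1
  ring

lemma dX_expi (a : ℝ) : dX (fun z => expi (a * z.2)) = 0 := by
  funext z
  have h := congrFun (congrFun (pdX_eq (smooth_expi a)) z.1) z.2
  rw [show dX (fun z => expi (a * z.2)) z = _ from h.symm]
  simp [pdX]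

lemma dY_expi (a : ℝ) : dY (fun z => expi (a * z.2))
    = (2 * Real.pi * I * a : ℂ) • (fun z => expi (a * z.2)) := by
  funext z
  have h := congrFun (congrFun (pdY_eq (smooth_expi a)) z.1) z.2
  rw [show dY (fun z => expi (a * z.2)) z = _ from h.symm]
  exact (hasDerivAt_expi a z.2).deriv

lemma norm_D_expi (a : ℝ) (n : ℕ) (z : ℝ × ℝ) :
    ‖iteratedFDeriv ℝ n (fun z => expi (a * z.2)) z‖ ≤ (2 * Real.pi * |a|) ^ n := by
  induction n with
  | zero => simp [norm_expi]
  | succ n ih =>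
    refine (norm_D_succ_le (smooth_expi a) n z).trans ?_
    rw [dX_expi, dY_expi, iteratedFDeriv_const_smul_apply ((smooth_expi a).nat n).contDiffAt,
      norm_smul]
    have h0 : iteratedFDeriv ℝ n (0 : ℝ × ℝ → ℂ) z = 0 := by
      rw [show (0 : ℝ × ℝ → ℂ) = fun _ => 0 from rfl, iteratedFDeriv_fun_zero]; rfl
    rw [h0, norm_zero, zero_add, pow_succ']
    have : ‖(2 * Real.pi * I * a : ℂ)‖ = 2 * Real.pi * |a| := by
      simp [abs_of_pos Real.pi_pos]
    rw [this]
    gcongr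

lemma smooth_tsum (f : ℤ → ℝ × ℝ → ℂ) (hf : ∀ q, Smooth (f q))
    (hb : ∀ (n : ℕ) (R : ℝ), ∃ u : ℤ → ℝ, Summable u ∧
      ∀ q z, ‖z‖ ≤ R → ‖iteratedFDeriv ℝ n (f q) z‖ ≤ u q) :
    Smooth (fun z => ∑' q, f q z) ∧
    ∀ (n : ℕ) (z : ℝ × ℝ), iteratedFDeriv ℝ n (fun z => ∑' q, f q z) z
      = ∑' q, iteratedFDeriv ℝ n (f q) z := by
  have key : ∀ R : ℝ, 0 < R → ∃ g : ℤ → ℝ × ℝ → ℂ,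
      (∀ q z, ‖z‖ < R → g q z = f q z) ∧ Smooth (fun z => ∑' q, g q z) ∧
      ∀ (n : ℕ) (z : ℝ × ℝ), iteratedFDeriv ℝ n (fun z => ∑' q, g q z) z
        = ∑' q, iteratedFDeriv ℝ n (g q) z := by
    intro R hR
    let χ : ContDiffBump (0 : ℝ × ℝ) := ⟨R, R + 1, hR, by linarith⟩
    have hχ : ContDiff ℝ (⊤ : ℕ∞) χ := χ.contDiff
    have hχb : ∀ i : ℕ, ∃ B : ℝ, ∀ z, ‖iteratedFDeriv ℝ i χ z‖ ≤ B := by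
      intro i
      exact (hχ.continuous_iteratedFDeriv (m := i)
        (by exact_mod_cast le_top)).bounded_above_of_compact_support
          (χ.hasCompactSupport.iteratedFDeriv i)
    choose B hB using hχb
    have hB0 : ∀ i, 0 ≤ B i := fun i => (norm_nonneg _).trans (hB i 0)
    choose u hu hu' using fun n => hb n (R + 1)
    have hu0 : ∀ n q, 0 ≤ u n q := fun n q =>
      (norm_nonneg _).trans (hu' n q 0 (by simpa using by linarith))
    let g : ℤ → ℝ × ℝ → ℂ := fun q z => χ z • f q z
    let v : ℕ → ℤ → ℝ := fun k q =>
      ∑ i ∈ Finset.range (k + 1), (k.choose i : ℝ) * B i * u (k - i) q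
    have hg : ∀ q, Smooth (g q) := fun q => hχ.smul (hf q)
    have hv : ∀ k : ℕ, (k : ℕ∞) ≤ ⊤ → Summable (v k) := fun k _ =>
      summable_sum fun i _ => (hu (k - i)).mul_left _
    have hgv : ∀ (k : ℕ) (q : ℤ) (z : ℝ × ℝ), (k : ℕ∞) ≤ ⊤ →
        ‖iteratedFDeriv ℝ k (g q) z‖ ≤ v k q := by
      intro k q z _
      by_cases hz : ‖z‖ ≤ R + 1
      · refine (norm_iteratedFDeriv_smul_le hχ (hf q) z (n := k)
          (by exact_mod_cast le_top)).trans ?_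
        refine Finset.sum_le_sum fun i _ => ?_
        have := hu' (k - i) q z hz
        have := hB i z
        have := hB0 i
        gcongr
      · have hev : g q =ᶠ[nhds z] fun _ => 0 := by
          have : {z : ℝ × ℝ | R + 1 < ‖z‖} ∈ nhds z :=
            (isOpen_lt continuous_const continuous_norm).mem_nhds (not_le.1 hz)
          filter_upwards [this] with w hw
          have : χ w = 0 := χ.zero_of_le_dist (by simpa [χ] using hw.le)
          simp [g, this]
        rw [(hev.iteratedFDeriv ℝ k).eq_of_nhds, iteratedFDeriv_fun_zero]
        simp only [Pi.zero_apply, norm_zero]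
        exact Finset.sum_nonneg fun i _ =>
          mul_nonneg (mul_nonneg (by positivity) (hB0 i)) (hu0 _ _)
    refine ⟨g, ?_, contDiff_tsum (N := (⊤ : ℕ∞)) hg hv hgv, fun n z =>
      iteratedFDeriv_tsum_apply (N := (⊤ : ℕ∞)) hg hv hgv le_top z⟩
    intro q z hz
    have : χ z = 1 := χ.one_of_mem_closedBall (by simpa [χ] using hz.le)
    simp [g, this]
  have ball : ∀ z : ℝ × ℝ, {w : ℝ × ℝ | ‖w‖ < ‖z‖ + 1} ∈ nhds z := fun z =>
    (isOpen_lt continuous_norm continuous_const).mem_nhds (by simp)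
  constructor
  · refine contDiff_iff_contDiffAt.2 fun z => ?_
    obtain ⟨g, hg, hs, _⟩ := key (‖z‖ + 1) (by positivity)
    refine hs.contDiffAt.congr_of_eventuallyEq ?_
    filter_upwards [ball z] with w hw
    exact tsum_congr fun q => (hg q w hw).symm
  · intro n z
    obtain ⟨g, hg, _, hd⟩ := key (‖z‖ + 1) (by positivity)
    have h1 : (fun z => ∑' q, f q z) =ᶠ[nhds z] fun z => ∑' q, g q z := by
      filter_upwards [ball z] with w hw
      exact tsum_congr fun q => (hg q w hw).symm
    rw [(h1.iteratedFDeriv ℝ n).eq_of_nhds, hd]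
    refine tsum_congr fun q => ?_
    have h2 : g q =ᶠ[nhds z] f q := by
      filter_upwards [ball z] with w hw
      exact hg q w hw
    exact (h2.iteratedFDeriv ℝ n).eq_of_nhds

/-- The slice of a function at `p`, uncurried. -/
def slice (Φ : ℝ → ℝ → ℤ → ℂ) (p : ℤ) : ℝ × ℝ → ℂ := fun z => Φ z.1 z.2 p

lemma IsSc.smooth {c : ℕ} {Φ : ℝ → ℝ → ℤ → ℂ} (h : IsSc c Φ) (p : ℤ) : Smooth (slice Φ p) := h.1 p

lemma IsSc.compact_bound {c : ℕ} {Φ : ℝ → ℝ → ℤ → ℂ} (h : IsSc c Φ) {K : Set (ℝ × ℝ)}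
    (hK : IsCompact K) (k N : ℕ) :
    ∃ C : ℝ, ∀ p, ∀ z ∈ K, wt p ^ N * ‖iteratedFDeriv ℝ k (slice Φ p) z‖ ≤ C := by
  refine bound_D K k (slice Φ) h.smooth (fun m n N => ?_) N
  obtain ⟨C, hC⟩ := h.2.2.2 ((1 + Polynomial.X ^ 2) ^ N) m n K hK
  refine ⟨2 ^ N * C, fun p z hz => ?_⟩
  have h1 := hC z.1 z.2 p hz
  have h2 := pd_eq (h.smooth p) m n z.1 z.2
  change pdX^[m] (pdY^[n] fun x' y' => Φ x' y' p) z.1 z.2 = dX^[m] (dY^[n] (slice Φ p)) z at h2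
  rw [h2, norm_mul] at h1
  have h3 : ‖(((((1 + Polynomial.X ^ 2) ^ N : Polynomial ℤ).eval p : ℤ)) : ℂ)‖
      = (1 + (p : ℝ) ^ 2) ^ N := by
    rw [Complex.norm_intCast]
    simp only [Polynomial.eval_pow, Polynomial.eval_add, Polynomial.eval_one, Polynomial.eval_X]
    push_cast
    exact abs_of_nonneg (by positivity)
  rw [h3] at h1
  have h4 : wt p ^ N ≤ 2 ^ N * (1 + (p : ℝ) ^ 2) ^ N := by
    rw [← mul_pow]
    have := (wt_pos p).le
    gcongr
    rw [← sq_abs (p : ℝ), wt]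
    nlinarith [sq_nonneg (|(p : ℝ)| - 1), sq_nonneg (|(p : ℝ)|)]
  calc _ ≤ (2 ^ N * (1 + (p : ℝ) ^ 2) ^ N) * ‖dX^[m] (dY^[n] (slice Φ p)) z‖ := by gcongr
    _ = 2 ^ N * ((1 + (p : ℝ) ^ 2) ^ N * ‖dX^[m] (dY^[n] (slice Φ p)) z‖) := by ring
    _ ≤ _ := by gcongr

lemma IsSc.strip_bound {c : ℕ} {Φ : ℝ → ℝ → ℤ → ℂ} (h : IsSc c Φ) (k N : ℕ) :
    ∃ C : ℝ, 0 ≤ C ∧ ∀ p, ∀ z : ℝ × ℝ, z.1 ∈ Set.Icc (0 : ℝ) 1 →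
      wt p ^ N * ‖iteratedFDeriv ℝ k (slice Φ p) z‖ ≤ C := by
  obtain ⟨C, hC⟩ := h.compact_bound
    (isCompact_Icc.prod isCompact_Icc : IsCompact (Set.Icc (0 : ℝ) 1 ×ˢ Set.Icc (0 : ℝ) 1)) k N
  have hC0 : 0 ≤ C := le_trans (mul_nonneg (pow_pos (wt_pos 0) N).le (norm_nonneg _))
    (hC 0 (0, 0) (by simp))
  refine ⟨C, hC0, fun p z hz => ?_⟩
  have hper : (fun w => slice Φ p (w + (0, (⌊z.2⌋ : ℝ)))) = slice Φ p := by
    funext w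
    have : Function.Periodic (fun y => Φ w.1 y p) 1 := fun y => h.2.1 _ _ _
    have := this.int_mul ⌊z.2⌋ w.2
    simpa [slice] using this
  have h2 := hC p (z.1, Int.fract z.2)
    ⟨hz, Int.fract_nonneg _, (Int.fract_lt_one _).le⟩
  rw [← hper, iteratedFDeriv_comp_add_right] at h2
  have hz' : ((z.1, Int.fract z.2) : ℝ × ℝ) + (0, (⌊z.2⌋ : ℝ)) = z := by
    ext <;> simp
  rwa [hz'] at h2

lemma IsSc.global_bound {c : ℕ} {Φ : ℝ → ℝ → ℤ → ℂ} (h : IsSc c Φ) (n N : ℕ) :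
    ∃ C : ℝ, 0 ≤ C ∧ ∀ p, ∀ z : ℝ × ℝ,
      wt p ^ N * ‖iteratedFDeriv ℝ n (slice Φ p) z‖ ≤ C * (1 + ‖z‖) ^ n := by
  choose C hC0 hC using fun j => h.strip_bound j (N + n)
  refine ⟨∑ i ∈ Finset.range (n + 1), (n.choose i : ℝ) * (2 * Real.pi * c) ^ i * C (n - i),
    Finset.sum_nonneg fun i _ => mul_nonneg (by positivity) (hC0 _), fun p z => ?_⟩
  set k : ℤ := ⌊z.1⌋ with hk
  set t : ℝ × ℝ := (Int.fract z.1, z.2) with ht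
  have ht1 : t.1 ∈ Set.Icc (0 : ℝ) 1 := ⟨Int.fract_nonneg _, (Int.fract_lt_one _).le⟩
  set a : ℝ := (c : ℝ) * k * p with ha
  have hper : (fun w => slice Φ p (w + ((k : ℝ), 0)))
      = fun w => (fun z : ℝ × ℝ => expi (a * z.2)) w * slice Φ p w := by
    funext w
    simpa [slice] using h.2.2.1 k w.1 w.2 p
  have hz' : t + ((k : ℝ), 0) = z := by
    ext <;> simp [ht, hk]
  have h1 : iteratedFDeriv ℝ n (slice Φ p) z
      = iteratedFDeriv ℝ n (fun w => (fun z : ℝ × ℝ => expi (a * z.2)) w * slice Φ p w) t := by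
    rw [← hper, iteratedFDeriv_comp_add_right, hz']
  have hkz : |(k : ℝ)| ≤ 1 + ‖z‖ := by
    have h2 : (k : ℝ) = z.1 - Int.fract z.1 := by rw [hk, Int.self_sub_fract]
    have h3 : |z.1| ≤ ‖z‖ := norm_fst_le z
    have h4 : |(k : ℝ)| ≤ |z.1| + |Int.fract z.1| := by rw [h2]; exact abs_sub _ _
    have h5 : |Int.fract z.1| ≤ 1 := by
      rw [abs_of_nonneg (Int.fract_nonneg _)]; exact (Int.fract_lt_one _).le
    linarith
  have hw := one_le_wt p
  have hw0 := wt_pos p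
  have hab : |a| ≤ c * ((1 + ‖z‖) * wt p) := by
    rw [ha, abs_mul, abs_mul, Nat.abs_cast, mul_assoc]
    gcongr
    simp [wt]
  have h2 := norm_iteratedFDeriv_mul_le (smooth_expi a) (h.smooth p) t (n := n)
    (by exact_mod_cast le_top)
  rw [h1]
  refine (mul_le_mul_of_nonneg_left h2 (by positivity)).trans ?_
  rw [Finset.mul_sum, Finset.sum_mul]
  refine Finset.sum_le_sum fun i hi => ?_
  have hin : i ≤ n := by simpa [Nat.lt_succ_iff] using hi
  set G := ‖iteratedFDeriv ℝ (n - i) (slice Φ p) t‖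
  have h3 : ‖iteratedFDeriv ℝ i (fun z : ℝ × ℝ => expi (a * z.2)) t‖
      ≤ (2 * Real.pi * c) ^ i * (1 + ‖z‖) ^ n * wt p ^ n := by
    refine (norm_D_expi a i t).trans ?_
    calc (2 * Real.pi * |a|) ^ i ≤ (2 * Real.pi * (c * ((1 + ‖z‖) * wt p))) ^ i := by gcongr
      _ = (2 * Real.pi * c) ^ i * (1 + ‖z‖) ^ i * wt p ^ i := by rw [← mul_pow, ← mul_pow]; ring
      _ ≤ _ := by
        have : 1 ≤ 1 + ‖z‖ := by simp
        gcongr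
  have h4 : wt p ^ (N + n) * G ≤ C (n - i) := hC (n - i) p t ht1
  calc _ ≤ wt p ^ N * ((n.choose i : ℝ) * ((2 * Real.pi * c) ^ i * (1 + ‖z‖) ^ n * wt p ^ n) * G) := by
        gcongr
    _ = (n.choose i : ℝ) * (2 * Real.pi * c) ^ i * (wt p ^ (N + n) * G) * (1 + ‖z‖) ^ n := by
        rw [pow_add]; ring
    _ ≤ _ := by gcongr

/-- The summand of the star product. -/
def summand (v : ℝ × ℝ) (Φ Ψ : ℝ → ℝ → ℤ → ℂ) (p q : ℤ) : ℝ × ℝ → ℂ := fun z =>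
  slice Φ q (z - ((q : ℝ) - p) • v) * slice Ψ (p - q) (z - (q : ℝ) • v)

lemma summand_smooth {c : ℕ} (v : ℝ × ℝ) {Φ Ψ : ℝ → ℝ → ℤ → ℂ} (hΦ : IsSc c Φ) (hΨ : IsSc c Ψ)
    (p q : ℤ) : Smooth (summand v Φ Ψ p q) :=
  ((hΦ.smooth q).comp (contDiff_id.sub contDiff_const)).mul
    ((hΨ.smooth (p - q)).comp (contDiff_id.sub contDiff_const))

lemma shift_bound (z v : ℝ × ℝ) (r s : ℝ) (h : |r| ≤ s) :
    1 + ‖z - r • v‖ ≤ (1 + ‖z‖) * (1 + ‖v‖) * (1 + s) := by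
  have h1 : ‖z - r • v‖ ≤ ‖z‖ + |r| * ‖v‖ := by
    refine (norm_sub_le _ _).trans_eq ?_
    rw [norm_smul, Real.norm_eq_abs]
  have hs : 0 ≤ s := (abs_nonneg r).trans h
  have h2 : |r| * ‖v‖ ≤ s * ‖v‖ := by gcongr
  have := norm_nonneg z
  have := norm_nonneg v
  have : 0 ≤ ‖z‖ * ‖v‖ := by positivity
  have : 0 ≤ ‖z‖ * s := by positivity
  have : 0 ≤ ‖v‖ * s := by positivity
  have : 0 ≤ ‖z‖ * ‖v‖ * s := by positivity
  nlinarith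

lemma summand_bound {c : ℕ} (v : ℝ × ℝ) {Φ Ψ : ℝ → ℝ → ℤ → ℂ} (hΦ : IsSc c Φ) (hΨ : IsSc c Ψ)
    (n M : ℕ) : ∃ C : ℝ, 0 ≤ C ∧ ∀ (p q : ℤ) (z : ℝ × ℝ),
      wt p ^ M * wt q ^ 2 * ‖iteratedFDeriv ℝ n (summand v Φ Ψ p q) z‖
        ≤ C * (1 + ‖z‖) ^ (2 * n) := by
  choose A hA0 hA using fun j => hΦ.global_bound j (n + M + 2)
  choose B hB0 hB using fun j => hΨ.global_bound j (n + M)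
  refine ⟨∑ i ∈ Finset.range (n + 1), (n.choose i : ℝ) * A i * B (n - i) * (1 + ‖v‖) ^ (2 * n),
    Finset.sum_nonneg fun i _ => mul_nonneg (mul_nonneg (mul_nonneg (by positivity) (hA0 _))
      (hB0 _)) (by positivity), fun p q z => ?_⟩
  have hf : Smooth fun z => slice Φ q (z - ((q : ℝ) - p) • v) :=
    (hΦ.smooth q).comp (contDiff_id.sub contDiff_const)
  have hg : Smooth fun z => slice Ψ (p - q) (z - (q : ℝ) • v) :=
    (hΨ.smooth (p - q)).comp (contDiff_id.sub contDiff_const)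
  have h2 := norm_iteratedFDeriv_mul_le hf hg z (n := n) (by exact_mod_cast le_top)
  change ‖iteratedFDeriv ℝ n (summand v Φ Ψ p q) z‖ ≤ _ at h2
  have hp := wt_pos p
  have hq := wt_pos q
  have hr := wt_pos (p - q)
  refine (mul_le_mul_of_nonneg_left h2 (by positivity)).trans ?_
  rw [Finset.mul_sum, Finset.sum_mul]
  refine Finset.sum_le_sum fun i hi => ?_
  have hin : i ≤ n := by simpa [Nat.lt_succ_iff] using hi
  rw [iteratedFDeriv_comp_sub, iteratedFDeriv_comp_sub]
  have hA' := hA i q (z - ((q : ℝ) - p) • v)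
  have hB' := hB (n - i) (p - q) (z - (q : ℝ) • v)
  set G := ‖iteratedFDeriv ℝ i (slice Φ q) (z - ((q : ℝ) - p) • v)‖
  set H := ‖iteratedFDeriv ℝ (n - i) (slice Ψ (p - q)) (z - (q : ℝ) • v)‖
  have hG : 0 ≤ G := norm_nonneg _
  have hH : 0 ≤ H := norm_nonneg _
  have s1 : (1 + ‖z - ((q : ℝ) - p) • v‖) ^ i ≤ ((1 + ‖z‖) * (1 + ‖v‖)) ^ n * wt (p - q) ^ n := by
    rw [← mul_pow]
    have h0 := shift_bound z v ((q : ℝ) - p) |((p - q : ℤ) : ℝ)| (by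
      push_cast; rw [abs_sub_comm])
    exact (pow_le_pow_right₀ (by simp) hin).trans (pow_le_pow_left₀ (by positivity) h0 n)
  have s2 : (1 + ‖z - (q : ℝ) • v‖) ^ (n - i) ≤ ((1 + ‖z‖) * (1 + ‖v‖)) ^ n * wt q ^ n := by
    rw [← mul_pow]
    have h0 := shift_bound z v (q : ℝ) |(q : ℝ)| le_rfl
    exact (pow_le_pow_right₀ (by simp) (Nat.sub_le n i)).trans
      (pow_le_pow_left₀ (by positivity) h0 n)
  set Z := ((1 + ‖z‖) * (1 + ‖v‖)) ^ n with hZ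
  have hZ0 : 0 ≤ Z := by positivity
  have e1 : wt q ^ (n + M + 2) * G ≤ A i * (Z * wt (p - q) ^ n) :=
    hA'.trans (mul_le_mul_of_nonneg_left s1 (hA0 i))
  have e2 : wt (p - q) ^ (n + M) * H ≤ B (n - i) * (Z * wt q ^ n) :=
    hB'.trans (mul_le_mul_of_nonneg_left s2 (hB0 _))
  have e3 := mul_le_mul e1 e2 (by positivity) (mul_nonneg (hA0 i) (by positivity))
  have e4 : wt q ^ M * wt (p - q) ^ M * wt q ^ 2 * (G * H) ≤ A i * B (n - i) * Z ^ 2 := by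
    have hpos : 0 < wt q ^ n * wt (p - q) ^ n := by positivity
    refine le_of_mul_le_mul_left ?_ hpos
    calc _ = wt q ^ (n + M + 2) * G * (wt (p - q) ^ (n + M) * H) := by
          simp only [pow_add]; ring
      _ ≤ _ := e3
      _ = _ := by ring
  have e5 : wt p ^ M ≤ wt q ^ M * wt (p - q) ^ M := by
    rw [← mul_pow]; exact pow_le_pow_left₀ hp.le (wt_le_mul p q) M
  calc _ = (n.choose i : ℝ) * (wt p ^ M * wt q ^ 2 * (G * H)) := by ring
    _ ≤ (n.choose i : ℝ) * (wt q ^ M * wt (p - q) ^ M * wt q ^ 2 * (G * H)) := by gcongr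
    _ ≤ (n.choose i : ℝ) * (A i * B (n - i) * Z ^ 2) := by gcongr
    _ = _ := by rw [hZ, mul_pow]; ring

lemma summand_bound' {c : ℕ} (v : ℝ × ℝ) {Φ Ψ : ℝ → ℝ → ℤ → ℂ} (hΦ : IsSc c Φ) (hΨ : IsSc c Ψ)
    (n M : ℕ) (R : ℝ) : ∃ C : ℝ, 0 ≤ C ∧ ∀ (p q : ℤ) (z : ℝ × ℝ), ‖z‖ ≤ R →
      ‖iteratedFDeriv ℝ n (summand v Φ Ψ p q) z‖ ≤ C * (wt p ^ M)⁻¹ * (wt q ^ 2)⁻¹ := by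
  obtain ⟨C, hC0, hC⟩ := summand_bound v hΦ hΨ n M
  refine ⟨C * (1 + |R|) ^ (2 * n), by positivity, fun p q z hz => ?_⟩
  have hp := wt_pos p
  have hq := wt_pos q
  have h := hC p q z
  have h1 : C * (1 + ‖z‖) ^ (2 * n) ≤ C * (1 + |R|) ^ (2 * n) := by
    have := hz.trans (le_abs_self R)
    gcongr
  rw [mul_assoc, ← mul_inv, ← div_eq_mul_inv, le_div_iff₀ (by positivity), mul_comm]
  exact h.trans h1

lemma starProd_eq (hbar μ ν : ℝ) (Φ Ψ : ℝ → ℝ → ℤ → ℂ) (p : ℤ) :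
    (fun z : ℝ × ℝ => starProd hbar μ ν Φ Ψ z.1 z.2 p)
      = fun z => ∑' q, summand (hbar * μ, hbar * ν) Φ Ψ p q z := by
  funext z
  simp only [starProd, summand, slice]
  refine tsum_congr fun q => ?_
  simp only [Prod.fst_sub, Prod.snd_sub, Prod.smul_fst, Prod.smul_snd, smul_eq_mul]
  congr 2 <;> ring

lemma expi_add (x y : ℝ) : expi (x + y) = expi x * expi y := by
  unfold expi
  rw [← Complex.exp_add]
  push_cast
  ring_nf

/-- For all `Φ, Ψ ∈ S^c` and all `(x,y,p) ∈ ℝ × 𝕋 × ℤ`, the series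
defining `(Φ★Ψ)(x,y,p)` converges absolutely, and `Φ★Ψ ∈ S^c`. -/
theorem starProd_summable_and_mem_Sc (c : ℕ) (hc : 0 < c) (hbar μ ν : ℝ)
    (hμν : μ ^ 2 + ν ^ 2 ≠ 0) (Φ Ψ : ℝ → ℝ → ℤ → ℂ) (hΦ : IsSc c Φ) (hΨ : IsSc c Ψ) :
    (∀ (x y : ℝ) (p : ℤ), Summable fun q : ℤ =>
      ‖Φ (x - hbar * ((q : ℝ) - (p : ℝ)) * μ) (y - hbar * ((q : ℝ) - (p : ℝ)) * ν) q *
        Ψ (x - hbar * (q : ℝ) * μ) (y - hbar * (q : ℝ) * ν) (p - q)‖) ∧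
    IsSc c (starProd hbar μ ν Φ Ψ) := by
  set v : ℝ × ℝ := (hbar * μ, hbar * ν) with hv
  have hsm : ∀ p, ∀ (n : ℕ) (R : ℝ), ∃ u : ℤ → ℝ, Summable u ∧
      ∀ q z, ‖z‖ ≤ R → ‖iteratedFDeriv ℝ n (summand v Φ Ψ p q) z‖ ≤ u q := by
    intro p n R
    obtain ⟨C, _, hC⟩ := summand_bound' v hΦ hΨ n 0 R
    exact ⟨_, summable_wt.mul_left (C * (wt p ^ 0)⁻¹), fun q z hz => hC p q z hz⟩
  have hts := fun p => smooth_tsum (summand v Φ Ψ p) (summand_smooth v hΦ hΨ p) (hsm p)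
  refine ⟨fun x y p => ?_, fun p => ?_, fun x y p => ?_, fun k x y p => ?_, fun P m n K hK => ?_⟩
  · obtain ⟨u, hu, hu'⟩ := hsm p 0 ‖((x, y) : ℝ × ℝ)‖
    refine Summable.of_nonneg_of_le (fun _ => norm_nonneg _) (fun q => ?_) hu
    have h := hu' q (x, y) le_rfl
    rw [norm_iteratedFDeriv_zero] at h
    refine le_trans (le_of_eq ?_) h
    simp only [summand, slice, hv, Prod.fst_sub, Prod.snd_sub, Prod.smul_fst, Prod.smul_snd,
      smul_eq_mul]
    congr 3 <;> ring
  · rw [starProd_eq]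
    exact (hts p).1
  · simp only [starProd]
    refine tsum_congr fun q => ?_
    rw [add_sub_right_comm, add_sub_right_comm, hΦ.2.1, hΨ.2.1]
  · simp only [starProd]
    rw [← tsum_mul_left]
    refine tsum_congr fun q => ?_
    rw [add_sub_right_comm x, add_sub_right_comm x, hΦ.2.2.1, hΨ.2.2.1]
    rw [show (c : ℝ) * k * p * y = (c : ℝ) * k * q * (y - hbar * ((q : ℝ) - p) * ν)
      + (c : ℝ) * k * ((p - q : ℤ) : ℝ) * (y - hbar * q * ν) by push_cast; ring, expi_add]
    ring
  · obtain ⟨A, N, hA0, hA⟩ := poly_bound P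
    obtain ⟨R, hR⟩ := hK.isBounded.exists_norm_le
    obtain ⟨C, hC0, hC⟩ := summand_bound' v hΦ hΨ (m + n) N R
    refine ⟨A * (C * ∑' q : ℤ, (wt q ^ 2)⁻¹), fun x y p hxy => ?_⟩
    have hp := wt_pos p
    have e1 := pd_eq (hts p).1 m n x y
    have e2 : (fun x' y' => starProd hbar μ ν Φ Ψ x' y' p)
        = fun x y => ∑' q, summand v Φ Ψ p q (x, y) := by
      funext x y
      exact congrFun (starProd_eq hbar μ ν Φ Ψ p) (x, y)
    rw [e2, e1, norm_mul, Complex.norm_intCast]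
    have e3 := norm_dXY_le (hts p).1 m n (x, y)
    rw [(hts p).2] at e3
    have e4 : ‖∑' q, iteratedFDeriv ℝ (m + n) (summand v Φ Ψ p q) (x, y)‖
        ≤ C * (wt p ^ N)⁻¹ * ∑' q : ℤ, (wt q ^ 2)⁻¹ :=
      tsum_of_norm_bounded (summable_wt.hasSum.mul_left _) fun q => hC p q (x, y) (hR _ hxy)
    calc _ ≤ (A * wt p ^ N) * (C * (wt p ^ N)⁻¹ * ∑' q : ℤ, (wt q ^ 2)⁻¹) :=
          mul_le_mul (hA p) (e3.trans e4) (norm_nonneg _) (by positivity)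
      _ = _ := by field_simp
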